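/- arXiv:2312.16655 — 4 statements merged into one kernel-verified Lean document; each statement's English description precedes it below -/
import Mathlib

section
/- Let V be a finite-dimensional real normed vector space, g : V → V a linear automorphism, and V = V⁺ ⊕ V⁰ ⊕ V⁻ an internal direct sum of g-invariant subspaces such that for some constant λ > 1 one has ‖g v‖ ≥ λ‖v‖ for all v ∈ V⁺, ‖g v‖ ≤ λ⁻¹‖v‖ for all v ∈ V⁻, and g v = v for all v ∈ V⁰. Then for every Y ∈ V there exists x ∈ V with g x + Y − x ∈ V⁰; equivalently, the affine subspace x + V⁰, parallel to V⁰, is invariant under the affine map (g,Y) : z ↦ g z + Y. Moreover this invariant affine subspace is unique: if x₁ and x₂ both satisfy g xᵢ + Y − xᵢ ∈ V⁰, then x₁ − x₂ ∈ V⁰. -/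
/-- An endomorphism which maps a finite-dimensional subspace to itself and has no kernel there maps
the subspace onto itself. -/
theorem exists_mem_apply_eq_of_mapsTo {K E : Type*} [DivisionRing K] [AddCommGroup E] [Module K E]
    (f : E →ₗ[K] E) (W : Submodule K E) [FiniteDimensional K W] (hW : ∀ v ∈ W, f v ∈ W)
    (hker : ∀ v ∈ W, f v = 0 → v = 0) {y : E} (hy : y ∈ W) : ∃ x ∈ W, f x = y := by
  have hinj : Function.Injective (f.restrict hW) := by
    rw [injective_iff_map_eq_zero]
    intro v hv
    exact Subtype.ext (hker v v.2 (congrArg Subtype.val hv))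
  obtain ⟨x, hx⟩ := LinearMap.injective_iff_surjective.mp hinj ⟨y, hy⟩
  exact ⟨x, x.2, congrArg Subtype.val hx⟩

/-- Every vector decomposes along three submodules whose sum is internally direct. -/
theorem DirectSum.IsInternal.exists_add_add_eq {R M : Type*} [Ring R] [AddCommGroup M] [Module R M]
    {A B C : Submodule R M} (h : DirectSum.IsInternal ![A, B, C]) (x : M) :
    ∃ a ∈ A, ∃ b ∈ B, ∃ c ∈ C, a + b + c = x := by
  have hle : (⨆ i, ![A, B, C] i) ≤ A ⊔ B ⊔ C := by
    refine iSup_le fun i => ?_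
    fin_cases i
    · exact le_sup_left.trans le_sup_left
    · exact le_sup_right.trans le_sup_left
    · exact le_sup_right
  have hx : x ∈ A ⊔ B ⊔ C := hle (h.submodule_iSup_eq_top ▸ Submodule.mem_top)
  obtain ⟨y, hy, c, hc, rfl⟩ := Submodule.mem_sup.mp hx
  obtain ⟨a, ha, b, hb, rfl⟩ := Submodule.mem_sup.mp hy
  exact ⟨a, ha, b, hb, c, hc, rfl⟩

/-- In an internal direct sum of three submodules, a sum of vectors of the outer two lies in the
middle one only if both vectors vanish. -/
theorem DirectSum.IsInternal.eq_zero_of_add_mem {R M : Type*} [Ring R] [AddCommGroup M] [Module R M]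
    {A B C : Submodule R M} (h : DirectSum.IsInternal ![A, B, C]) {a c : M} (ha : a ∈ A)
    (hc : c ∈ C) (hac : a + c ∈ B) : a = 0 ∧ c = 0 := by
  have hind := h.submodule_iSupIndep
  have hle (i j : Fin 3) (hij : j ≠ i) :
      ![A, B, C] j ≤ ⨆ k, ⨆ (_ : k ≠ i), ![A, B, C] k :=
    le_iSup₂_of_le j hij le_rfl
  constructor
  · refine Submodule.disjoint_def.mp (hind 0) a ha ?_
    simpa using Submodule.sub_mem _ (hle 0 1 (by decide) hac) (hle 0 2 (by decide) hc)
  · refine Submodule.disjoint_def.mp (hind 2) c hc ?_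
    simpa using Submodule.sub_mem _ (hle 2 1 (by decide) hac) (hle 2 0 (by decide) ha)

/-- Let V be a finite-dimensional real normed vector space, g a linear
automorphism of V, and V = V⁺ ⊕ V⁰ ⊕ V⁻ an internal direct sum of g-invariant subspaces
such that for some λ > 1: ‖g v‖ ≥ λ‖v‖ on V⁺, ‖g v‖ ≤ λ⁻¹‖v‖ on V⁻, and g v = v on V⁰.
Then for every Y there is x with g x + Y − x ∈ V⁰ (i.e. the affine subspace x + V⁰ is
invariant under z ↦ g z + Y), and this invariant affine subspace is unique: if x₁, x₂ both
work then x₁ − x₂ ∈ V⁰. -/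
theorem unique_invariant_affine_subspace
    (V : Type*) [NormedAddCommGroup V] [NormedSpace ℝ V] [FiniteDimensional ℝ V]
    (g : V ≃ₗ[ℝ] V) (Vp V0 Vm : Submodule ℝ V)
    (hinternal : DirectSum.IsInternal ![Vp, V0, Vm])
    (hgp : ∀ v ∈ Vp, g v ∈ Vp) (hg0 : ∀ v ∈ V0, g v ∈ V0) (hgm : ∀ v ∈ Vm, g v ∈ Vm)
    (lam : ℝ) (hlam : 1 < lam)
    (hexp : ∀ v ∈ Vp, lam * ‖v‖ ≤ ‖g v‖)
    (hcon : ∀ v ∈ Vm, ‖g v‖ ≤ lam⁻¹ * ‖v‖)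
    (hfix : ∀ v ∈ V0, g v = v) :
    ∀ Y : V,
      (∃ x : V, g x + Y - x ∈ V0) ∧
      (∀ x₁ x₂ : V, g x₁ + Y - x₁ ∈ V0 → g x₂ + Y - x₂ ∈ V0 → x₁ - x₂ ∈ V0) := by
  intro Y
  let f : V →ₗ[ℝ] V := g.toLinearMap - LinearMap.id
  have hf (v : V) : f v = g v - v := rfl
  have hfp : ∀ v ∈ Vp, f v ∈ Vp := fun v hv => Vp.sub_mem (hgp v hv) hv
  have hfm : ∀ v ∈ Vm, f v ∈ Vm := fun v hv => Vm.sub_mem (hgm v hv) hv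
  have hf0 : ∀ v ∈ V0, f v = 0 := fun v hv => sub_eq_zero.mpr (hfix v hv)
  have hkerp : ∀ v ∈ Vp, f v = 0 → v = 0 := by
    intro v hv h
    have hle := hexp v hv
    rw [sub_eq_zero.mp ((hf v).symm.trans h)] at hle
    exact norm_le_zero_iff.mp (by nlinarith [norm_nonneg v])
  have hkerm : ∀ v ∈ Vm, f v = 0 → v = 0 := by
    intro v hv h
    have hle := hcon v hv
    rw [sub_eq_zero.mp ((hf v).symm.trans h)] at hle
    exact norm_le_zero_iff.mp (by nlinarith [norm_nonneg v, inv_lt_one_of_one_lt₀ hlam])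
  refine ⟨?_, fun x₁ x₂ h₁ h₂ => ?_⟩
  · obtain ⟨p, hp, z, hz, m, hm, rfl⟩ := hinternal.exists_add_add_eq Y
    obtain ⟨a, -, rfl⟩ := exists_mem_apply_eq_of_mapsTo f Vp hfp hkerp hp
    obtain ⟨c, -, rfl⟩ := exists_mem_apply_eq_of_mapsTo f Vm hfm hkerm hm
    refine ⟨-(a + c), ?_⟩
    convert hz using 1
    simp only [hf, map_neg, map_add]
    abel
  · have hx : f (x₁ - x₂) ∈ V0 := by
      convert V0.sub_mem h₁ h₂ using 1
      simp only [hf, map_sub]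
      abel
    obtain ⟨a, ha, b, hb, c, hc, habc⟩ := hinternal.exists_add_add_eq (x₁ - x₂)
    rw [← habc, map_add, map_add, hf0 b hb, add_zero] at hx
    obtain ⟨ha', hc'⟩ := hinternal.eq_zero_of_add_mem (hfp a ha) (hfm c hc) hx
    rw [← habc, hkerp a ha ha', hkerm c hc hc', zero_add, add_zero]
    exact hb
end

section
/- Let V, g, V⁺, V⁰, V⁻ and λ > 1 be as in the hypotheses, and let π⁰ : V → V⁰ be the linear projection with kernel V⁺ ⊕ V⁻. Then for every Y ∈ V there is a unique X ∈ V⁺ ⊕ V⁻ with X − g X = Y − π⁰ Y; for this X, conjugating the affine map (g,Y) by the translation z ↦ z + X yields the affine map (g, π⁰Y), i.e. g(z + X) + Y − X = g z + π⁰ Y for all z ∈ V. -/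
/-- A linear map that strictly expands one invariant subspace and strictly contracts another,
disjoint from it, has no nonzero fixed vector in their sum. -/
theorem eq_zero_of_fixed_of_expanding_contracting
    {V : Type*} [NormedAddCommGroup V] [Module ℝ V] (g : V →ₗ[ℝ] V) {Vp Vm : Submodule ℝ V}
    (hdisj : Disjoint Vp Vm) (hgp : ∀ v ∈ Vp, g v ∈ Vp) (hgm : ∀ v ∈ Vm, g v ∈ Vm)
    {lam : ℝ} (hlam : 1 < lam) (hexp : ∀ v ∈ Vp, lam * ‖v‖ ≤ ‖g v‖)
    (hcon : ∀ v ∈ Vm, ‖g v‖ ≤ lam⁻¹ * ‖v‖) {x : V} (hx : x ∈ Vp ⊔ Vm) (hfix : g x = x) :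
    x = 0 := by
  obtain ⟨p, hp, m, hm, rfl⟩ := Submodule.mem_sup.1 hx
  have heq : g p - p = m - g m := by
    rw [map_add] at hfix
    rw [sub_eq_sub_iff_add_eq_add, hfix, add_comm]
  have hzero : g p - p = 0 :=
    Submodule.disjoint_def.1 hdisj _ (Vp.sub_mem (hgp p hp) hp)
      (heq ▸ Vm.sub_mem hm (hgm m hm))
  have hp_fixed : g p = p := sub_eq_zero.1 hzero
  have hm_fixed : g m = m := (sub_eq_zero.1 (heq ▸ hzero)).symm
  have hp_norm := hexp p hp
  have hm_norm := hcon m hm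
  rw [hp_fixed] at hp_norm
  rw [hm_fixed] at hm_norm
  have hinv : lam⁻¹ < 1 := inv_lt_one_of_one_lt₀ hlam
  have hp0 : p = 0 := norm_le_zero_iff.1 (by nlinarith [norm_nonneg p])
  have hm0 : m = 0 := norm_le_zero_iff.1 (by nlinarith [norm_nonneg m])
  rw [hp0, hm0, add_zero]

/-- With V, g, V⁺, V⁰, V⁻ and λ > 1 as before, and π⁰ : V → V⁰ the linear
projection with kernel V⁺ ⊕ V⁻, for every Y there is a unique X ∈ V⁺ ⊕ V⁻ with
X − g X = Y − π⁰ Y; for this X, conjugating the affine map (g,Y) by the translation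
z ↦ z + X yields the affine map (g, π⁰Y): g(z + X) + Y − X = g z + π⁰ Y for all z. -/
theorem conjugate_to_neutral_translation
    (V : Type*) [NormedAddCommGroup V] [NormedSpace ℝ V] [FiniteDimensional ℝ V]
    (g : V ≃ₗ[ℝ] V) (Vp V0 Vm : Submodule ℝ V)
    (hinternal : DirectSum.IsInternal ![Vp, V0, Vm])
    (hgp : ∀ v ∈ Vp, g v ∈ Vp) (hg0 : ∀ v ∈ V0, g v ∈ V0) (hgm : ∀ v ∈ Vm, g v ∈ Vm)
    (lam : ℝ) (hlam : 1 < lam)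
    (hexp : ∀ v ∈ Vp, lam * ‖v‖ ≤ ‖g v‖)
    (hcon : ∀ v ∈ Vm, ‖g v‖ ≤ lam⁻¹ * ‖v‖)
    (hfix : ∀ v ∈ V0, g v = v)
    (pi0 : V →ₗ[ℝ] V)
    (hrange : ∀ v : V, pi0 v ∈ V0)
    (hid : ∀ v ∈ V0, pi0 v = v)
    (hker : LinearMap.ker pi0 = Vp ⊔ Vm) :
    ∀ Y : V, ∃ X : V,
      (X ∈ Vp ⊔ Vm ∧ X - g X = Y - pi0 Y) ∧
      (∀ X' : V, X' ∈ Vp ⊔ Vm → X' - g X' = Y - pi0 Y → X' = X) ∧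
      (∀ z : V, g (z + X) + Y - X = g z + pi0 Y) := by
  have hdisj : Disjoint Vp Vm :=
    hinternal.submodule_iSupIndep.pairwiseDisjoint (show (0 : Fin 3) ≠ 2 by decide)
  have hg : ∀ v ∈ Vp ⊔ Vm, g v ∈ Vp ⊔ Vm := by
    intro v hv
    obtain ⟨p, hp, m, hm, rfl⟩ := Submodule.mem_sup.1 hv
    rw [map_add]
    exact Submodule.add_mem_sup (hgp p hp) (hgm m hm)
  have hzero : ∀ x ∈ Vp ⊔ Vm, g x = x → x = 0 := fun x hx h =>
    eq_zero_of_fixed_of_expanding_contracting g.toLinearMap hdisj hgp hgm hlam hexp hcon hx h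
  let T : (Vp ⊔ Vm : Submodule ℝ V) →ₗ[ℝ] (Vp ⊔ Vm : Submodule ℝ V) :=
    LinearMap.id - g.toLinearMap.restrict hg
  have hT : ∀ x, (T x : V) = x - g x := fun _ => rfl
  have hinj : Function.Injective T := by
    refine (injective_iff_map_eq_zero T).2 fun x hx => Subtype.ext (hzero x x.2 ?_)
    have h : (x : V) - g x = 0 := by rw [← hT, hx, Submodule.coe_zero]
    exact (sub_eq_zero.1 h).symm
  intro Y
  have hY : Y - pi0 Y ∈ Vp ⊔ Vm := by
    rw [← hker, LinearMap.mem_ker, map_sub, hid _ (hrange Y), sub_self]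
  obtain ⟨X, hX⟩ := LinearMap.injective_iff_surjective.1 hinj ⟨Y - pi0 Y, hY⟩
  have hXY : (X : V) - g X = Y - pi0 Y := by rw [← hT, hX]
  refine ⟨X, ⟨X.2, hXY⟩, fun X' hX' h => ?_, fun z => ?_⟩
  · exact congrArg Subtype.val (@hinj ⟨X', hX'⟩ X (Subtype.ext (h.trans hXY.symm)))
  · have h : Y - X = pi0 Y - g X := by grind
    rw [map_add, add_sub_assoc, h]
    abel
end

section
/- Let g : (−1,1) → SLₙ(ℝ) be a differentiable curve such that g(0) = h·exp(a)·h⁻¹ for some h ∈ SLₙ(ℝ) and a ∈ 𝔞 with a₁₁ > a₂₂ > ⋯ > aₙₙ (so g(0) is loxodromic of positive type). Then there exist ε > 0 and functions λ₁, …, λₙ : (−ε,ε) → ℝ, each differentiable at 0, such that for every t ∈ (−ε,ε) each λᵢ(t) is an eigenvalue of g(t), λᵢ(0) = exp(aᵢᵢ), and for each index i the logarithmic derivative satisfies λᵢ′(0)/λᵢ(0) = (h⁻¹·g(0)⁻¹·g′(0)·h)ᵢᵢ; equivalently, the derivative at t = 0 of t ↦ (log λ₁(t), …, log λₙ(t))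 equals the Margulis invariant M(g(0), X) for X = g(0)⁻¹·g′(0). -/
open Filter Topology

section DetDerivative

variable {ι : Type*} [Fintype ι] [DecidableEq ι]

theorem Matrix.sum_det_updateRow_eq_trace {R : Type*} [CommRing R] (A X : Matrix ι ι R) :
    ∑ j, (A.updateRow j (X j)).det = (A.adjugate * X).trace := by
  rw [Matrix.trace_mul_comm]
  simp only [Matrix.trace, Matrix.diag_apply, Matrix.mul_apply]
  refine Finset.sum_congr rfl fun j _ => ?_
  rw [← Matrix.cramer_transpose_apply, Matrix.cramer_eq_adjugate_mulVec,
    ← Matrix.adjugate_transpose]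
  simp [Matrix.mulVec, dotProduct, mul_comm]

/-- The linear form `X ↦ tr (adj A * X)`, which is the derivative of the determinant at `A`. -/
noncomputable def Matrix.detDeriv (A : Matrix ι ι ℝ) : Matrix ι ι ℝ →L[ℝ] ℝ :=
  LinearMap.toContinuousLinearMap
    ((Matrix.traceLinearMap ι ℝ ℝ).comp (LinearMap.mulLeft ℝ A.adjugate))

theorem Matrix.detDeriv_apply (A X : Matrix ι ι ℝ) :
    A.detDeriv X = (A.adjugate * X).trace := rfl

/-- Jacobi's formula. -/
theorem Matrix.hasStrictFDerivAt_det (A : Matrix ι ι ℝ) :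
    HasStrictFDerivAt (fun M : Matrix ι ι ℝ => M.det) A.detDeriv A := by
  let D : ContinuousMultilinearMap ℝ (fun _ : ι => ι → ℝ) ℝ :=
    { toMultilinearMap := (Matrix.detRowAlternating (n := ι) (R := ℝ)).toMultilinearMap
      cont := continuous_id.matrix_det }
  have hD := D.hasStrictFDerivAt A
  have hL : D.linearDeriv A = A.detDeriv := ContinuousLinearMap.ext fun X =>
    (D.linearDeriv_apply A X).trans (Matrix.sum_det_updateRow_eq_trace A X)
  rw [← hL]
  exact hD

theorem Matrix.detDeriv_diagonal_apply {v : ι → ℝ} {i : ι} (hi : v i = 0) (X : Matrix ι ι ℝ) :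
    (Matrix.diagonal v).detDeriv X = (∏ j ∈ Finset.univ.erase i, v j) * X i i := by
  rw [Matrix.detDeriv_apply, Matrix.adjugate_diagonal]
  simp only [Matrix.trace, Matrix.diag_apply, Matrix.diagonal_mul]
  refine Finset.sum_eq_single i (fun j _ hj => ?_) (by simp)
  rw [Finset.prod_eq_zero (i := i) (by simp [hj.symm]) hi, zero_mul]

/-- Solving `F (k t, lam t) = F (k 0, y)` for `lam` along a curve `k` that is only assumed to be
differentiable at `0`. -/
theorem HasStrictFDerivAt.exists_hasDerivAt_implicit_along {E : Type*} [NormedAddCommGroup E]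
    [NormedSpace ℝ E] [CompleteSpace E] {F : E × ℝ → ℝ} {F' : E × ℝ →L[ℝ] ℝ} {k : ℝ → E}
    {k' : E} {y y' : ℝ} (hF : HasStrictFDerivAt F F' (k 0, y)) (hk : HasDerivAt k k' 0)
    (hF' : F' (0, 1) ≠ 0) (hy' : F' (k', y') = 0) :
    ∃ lam : ℝ → ℝ, HasDerivAt lam y' 0 ∧ lam 0 = y ∧ ∀ᶠ t in 𝓝 0, F (k t, lam t) = F (k 0, y) := by
  have hinv : (F' ∘L .inr ℝ E ℝ).IsInvertible := by
    refine ⟨ContinuousLinearEquiv.unitsEquivAut ℝ (Units.mk0 _ hF'), ?_⟩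
    ext
    simp
  let ψ := hF.implicitFunctionOfProdDomain hinv
  have hψ0 : ψ (k 0) = y :=
    (hF.eventually_apply_eq_iff_implicitFunctionOfProdDomain hinv).self_of_nhds.mp rfl
  have hψ := (hF.hasStrictFDerivAt_implicitFunctionOfProdDomain hinv).hasFDerivAt
  have hroot : ∀ᶠ t in 𝓝 0, F (k t, ψ (k t)) = F (k 0, y) :=
    hk.continuousAt.tendsto.eventually (hF.eventually_apply_implicitFunctionOfProdDomain hinv)
  have hlam : HasDerivAt (ψ ∘ k) (deriv (ψ ∘ k) 0) 0 :=
    (hψ.comp_hasDerivAt 0 hk).differentiableAt.hasDerivAt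
  have hF0 : HasFDerivAt F F' (k 0, (ψ ∘ k) 0) := by
    rw [Function.comp_apply, hψ0]
    exact hF.hasFDerivAt
  have hFk : F' (k', deriv (ψ ∘ k) 0) = 0 :=
    (hF0.comp_hasDerivAt 0 (hk.prodMk hlam)).unique
      ((hasDerivAt_const (0 : ℝ) (F (k 0, y))).congr_of_eventuallyEq hroot)
  have hsub : (deriv (ψ ∘ k) 0 - y') * F' (0, 1) = 0 := by
    rw [← smul_eq_mul, ← map_smul, Prod.smul_mk, smul_zero, smul_eq_mul, mul_one,
      ← sub_self k', ← Prod.mk_sub_mk, map_sub, hFk, hy', sub_zero]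
  have hder : deriv (ψ ∘ k) 0 = y' := sub_eq_zero.mp ((mul_eq_zero.mp hsub).resolve_right hF')
  exact ⟨ψ ∘ k, hder ▸ hlam, hψ0, hroot⟩

/-- A simple eigenvalue of a diagonal matrix extends, along any differentiable perturbation, to
a differentiable eigenvalue whose derivative is the corresponding diagonal entry of the velocity. -/
theorem Matrix.exists_hasDerivAt_eigenvalue_of_diagonal {d : ι → ℝ} (hd : Function.Injective d)
    {k : ℝ → Matrix ι ι ℝ} {k' : Matrix ι ι ℝ} (hk0 : k 0 = Matrix.diagonal d)
    (hk : HasDerivAt k k' 0) (i : ι) :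
    ∃ lam : ℝ → ℝ, HasDerivAt lam (k' i i) 0 ∧ lam 0 = d i ∧
      ∀ᶠ t in 𝓝 0, (k t).charpoly.IsRoot (lam t) := by
  let v : ι → ℝ := fun j => d i - d j
  have hc : ∏ j ∈ Finset.univ.erase i, v j ≠ 0 := Finset.prod_ne_zero_iff.mpr fun j hj =>
    sub_ne_zero.mpr fun h => (Finset.ne_of_mem_erase hj) (hd h).symm
  let T : Matrix ι ι ℝ × ℝ →L[ℝ] Matrix ι ι ℝ :=
    (ContinuousLinearMap.snd ℝ (Matrix ι ι ℝ) ℝ).smulRight (1 : Matrix ι ι ℝ) -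
      ContinuousLinearMap.fst ℝ (Matrix ι ι ℝ) ℝ
  have hT (M : Matrix ι ι ℝ) (s : ℝ) : T (M, s) = s • (1 : Matrix ι ι ℝ) - M := rfl
  have hT0 : T (k 0, d i) = Matrix.diagonal v := by
    rw [hT, hk0, Matrix.smul_one_eq_diagonal, Matrix.diagonal_sub]
  have hdet0 : (T (k 0, d i)).det = 0 := by
    rw [hT0, Matrix.det_diagonal, Finset.prod_eq_zero (Finset.mem_univ i) (sub_self _)]
  have hF : HasStrictFDerivAt (fun p => (T p).det) ((Matrix.diagonal v).detDeriv.comp T)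
      (k 0, d i) :=
    HasStrictFDerivAt.comp (E := (ι → ι → ℝ) × ℝ) (F := ι → ι → ℝ) (k 0, d i)
      (hT0 ▸ (T (k 0, d i)).hasStrictFDerivAt_det) T.hasStrictFDerivAt
  have hF'_apply (M : Matrix ι ι ℝ) (s : ℝ) :
      ((Matrix.diagonal v).detDeriv.comp T) (M, s) =
      (∏ j ∈ Finset.univ.erase i, v j) * (s - M i i) := by
    change (Matrix.diagonal v).detDeriv (s • (1 : Matrix ι ι ℝ) - M) = _
    rw [Matrix.detDeriv_diagonal_apply (v := v) (i := i) (sub_self _)]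
    simp
  obtain ⟨lam, hlam, hlam0, hroot⟩ := HasStrictFDerivAt.exists_hasDerivAt_implicit_along (E := ι → ι → ℝ)
    hF hk (y' := k' i i) ((hF'_apply 0 1).trans_ne (by simpa using hc))
    ((hF'_apply k' (k' i i)).trans (by rw [sub_self, mul_zero]))
  refine ⟨lam, hlam, hlam0, ?_⟩
  filter_upwards [hroot] with t ht
  rw [Polynomial.IsRoot, Matrix.eval_charpoly, Matrix.scalar_apply, ← Matrix.smul_one_eq_diagonal]
  exact ht.trans hdet0

end DetDerivative

/-- Let g : (−1,1) → SLₙ(ℝ) be a differentiable curve with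
g(0) = h·exp(a)·h⁻¹ for some h ∈ SLₙ(ℝ) and a traceless diagonal matrix a with strictly
decreasing diagonal entries (so g(0) is loxodromic of positive type). Then there exist
ε > 0 and functions λ₁, …, λₙ, differentiable at 0, such that for t ∈ (−ε,ε) each λᵢ(t)
is an eigenvalue of g(t), λᵢ(0) = exp(aᵢᵢ), and λᵢ′(0)/λᵢ(0) = (h⁻¹·g(0)⁻¹·g′(0)·h)ᵢᵢ,
i.e. the derivative at 0 of t ↦ (log λ₁(t),…,log λₙ(t)) is the Margulis invariant
M(g(0), g(0)⁻¹·g′(0)). -/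
theorem margulis_invariant_is_infinitesimal_jordan_projection
    (n : ℕ) (hn : 2 ≤ n)
    (g : ℝ → Matrix (Fin n) (Fin n) ℝ)
    (hdet : ∀ t ∈ Set.Ioo (-1 : ℝ) 1, (g t).det = 1)
    (hdiff : ∀ t ∈ Set.Ioo (-1 : ℝ) 1, DifferentiableAt ℝ g t)
    (h : Matrix (Fin n) (Fin n) ℝ) (hh : h.det = 1)
    (a : Fin n → ℝ) (ha : ∑ i, a i = 0) (hstrict : StrictAnti a)
    (hg0 : g 0 = h * Matrix.diagonal (fun i => Real.exp (a i)) * h⁻¹) :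
    ∃ ε > (0 : ℝ), ∃ lam : Fin n → ℝ → ℝ,
      (∀ i, DifferentiableAt ℝ (lam i) 0) ∧
      (∀ i, ∀ t ∈ Set.Ioo (-ε) ε, ((g t).charpoly).IsRoot (lam i t)) ∧
      (∀ i, lam i 0 = Real.exp (a i)) ∧
      (∀ i, deriv (lam i) 0 / lam i 0 = (h⁻¹ * (g 0)⁻¹ * deriv g 0 * h) i i) := by
  have hu : IsUnit h.det := by rw [hh]; exact isUnit_one
  have hinv : h⁻¹ * h = 1 := Matrix.nonsing_inv_mul h hu
  let d : Fin n → ℝ := fun i => Real.exp (a i)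
  have hk0 : h⁻¹ * g 0 * h = Matrix.diagonal d := by
    rw [hg0, ← Matrix.mul_assoc, ← Matrix.mul_assoc, hinv, Matrix.one_mul, Matrix.mul_assoc,
      hinv, Matrix.mul_one]
  let C : Matrix (Fin n) (Fin n) ℝ →L[ℝ] Matrix (Fin n) (Fin n) ℝ :=
    LinearMap.toContinuousLinearMap
      ((LinearMap.mulRight ℝ h).comp (LinearMap.mulLeft ℝ h⁻¹))
  have hk : HasDerivAt (fun t => h⁻¹ * g t * h) (h⁻¹ * deriv g 0 * h) 0 :=
    HasFDerivAt.comp_hasDerivAt (E := Fin n → Fin n → ℝ) (F := Fin n → Fin n → ℝ)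
      (0 : ℝ) C.hasFDerivAt (hdiff 0 (by norm_num)).hasDerivAt
  have hchar (t : ℝ) : (h⁻¹ * g t * h).charpoly = (g t).charpoly := by
    rw [Matrix.mul_assoc, Matrix.charpoly_mul_comm, Matrix.mul_assoc,
      Matrix.mul_nonsing_inv h hu, Matrix.mul_one]
  choose lam hlam hlam0 hroot using
    Matrix.exists_hasDerivAt_eigenvalue_of_diagonal (d := d)
      (Real.exp_injective.comp hstrict.injective) hk0 hk
  obtain ⟨ε, hε, hball⟩ := Metric.eventually_nhds_iff_ball.mp (eventually_all.mpr hroot)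
  refine ⟨ε, hε, lam, fun i => (hlam i).differentiableAt, fun i t ht => ?_, hlam0, fun i => ?_⟩
  · rw [← hchar]
    exact hball t (by rwa [Real.ball_eq_Ioo, zero_sub, zero_add]) i
  · have hg0u : IsUnit (g 0).det := by rw [hdet 0 (by norm_num)]; exact isUnit_one
    have hmul : Matrix.diagonal d * (h⁻¹ * (g 0)⁻¹ * deriv g 0 * h) = h⁻¹ * deriv g 0 * h := by
      calc Matrix.diagonal d * (h⁻¹ * (g 0)⁻¹ * deriv g 0 * h)
          = h⁻¹ * (g 0 * ((h * h⁻¹) * ((g 0)⁻¹ * (deriv g 0 * h)))) := by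
            rw [← hk0]; simp only [Matrix.mul_assoc]
        _ = h⁻¹ * ((g 0 * (g 0)⁻¹) * (deriv g 0 * h)) := by
            rw [Matrix.mul_nonsing_inv h hu, Matrix.one_mul, Matrix.mul_assoc (g 0)]
        _ = h⁻¹ * deriv g 0 * h := by
            rw [Matrix.mul_nonsing_inv _ hg0u, Matrix.one_mul, Matrix.mul_assoc]
    rw [(hlam i).deriv, hlam0 i, ← hmul, Matrix.diagonal_mul]
    exact mul_div_cancel_left₀ _ (Real.exp_ne_zero _)
end

section
/- Let a ∈ 𝔞 satisfy a₁₁ > a₂₂ > ⋯ > aₙₙ and let h₁, h₂ ∈ SLₙ(ℝ) satisfy h₁·exp(a)·h₁⁻¹ = h₂·exp(a)·h₂⁻¹. Then π₀(Ad(h₁)⁻¹ Y) = π₀(Ad(h₂)⁻¹ Y) for every Y ∈ 𝔰𝔩ₙ(ℝ); consequently the Margulis invariant M(g,Y) of a pair (g,Y) with g loxodromic of positive type does not depend on the choice of the conjugating element h. -/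
open Matrix

noncomputable section

/-- Projection onto the diagonal part (the projection π₀ : 𝔰𝔩ₙ(ℝ) → 𝔞 with kernel 𝔫⁺ ⊕ 𝔫⁻). -/
def pi0 {n : ℕ} : Matrix (Fin n) (Fin n) ℝ →ₗ[ℝ] Matrix (Fin n) (Fin n) ℝ where
  toFun Z := Matrix.diagonal (fun i => Z i i)
  map_add' X Y := by
    ext i j
    by_cases h : i = j <;> simp [Matrix.diagonal_apply, h]
  map_smul' c X := by
    ext i j
    by_cases h : i = j <;> simp [Matrix.diagonal_apply, h]

/-- A matrix commuting with a diagonal matrix whose entries are distinct is diagonal. -/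
theorem isDiag_of_commute_diagonal {ι R : Type*} [Fintype ι] [DecidableEq ι] [CommRing R]
    [IsDomain R] {d : ι → R} (hd : Function.Injective d) {M : Matrix ι ι R}
    (h : Commute M (Matrix.diagonal d)) : M.IsDiag := by
  intro i j hij
  have hM := congrFun (congrFun h.eq i) j
  rw [Matrix.mul_diagonal, Matrix.diagonal_mul, mul_comm] at hM
  exact (mul_eq_mul_right_iff.mp hM).resolve_left fun e => hij (hd e.symm)

/-- The diagonal part is invariant under conjugation by an invertible diagonal matrix. -/
theorem pi0_conj_of_isDiag {n : ℕ} {K L : Matrix (Fin n) (Fin n) ℝ} (hK : K.IsDiag)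
    (hLK : L * K = 1) (Z : Matrix (Fin n) (Fin n) ℝ) : pi0 (L * Z * K) = pi0 Z := by
  have hdiag : K = Matrix.diagonal K.diag := hK.diagonal_diag.symm
  have hLK_entry : ∀ i j, L i j * K j j = (1 : Matrix (Fin n) (Fin n) ℝ) i j := fun i j => by
    rw [← hLK, hdiag, Matrix.mul_diagonal, Matrix.diagonal_apply_eq]
  have hunit : ∀ i, L i i * K i i = 1 := fun i => by rw [hLK_entry, Matrix.one_apply_eq]
  have hL : L.IsDiag := fun i j hij =>
    (mul_eq_zero.mp ((hLK_entry i j).trans (Matrix.one_apply_ne hij))).resolve_right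
      (right_ne_zero_of_mul_eq_one (hunit j))
  refine congrArg Matrix.diagonal (funext fun i => ?_)
  rw [hdiag, ← hL.diagonal_diag, Matrix.mul_diagonal, Matrix.diagonal_mul, Matrix.diag_apply,
    Matrix.diag_apply, mul_right_comm, hunit, one_mul]

/-- Let a ∈ 𝔞 have strictly decreasing diagonal entries and let
h₁, h₂ ∈ SLₙ(ℝ) satisfy h₁·exp(a)·h₁⁻¹ = h₂·exp(a)·h₂⁻¹. Then
π₀(Ad(h₁)⁻¹ Y) = π₀(Ad(h₂)⁻¹ Y) for every Y ∈ 𝔰𝔩ₙ(ℝ); hence the Margulis invariant of a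
pair (g,Y) with g loxodromic of positive type does not depend on the choice of h. -/
theorem margulis_invariant_well_defined
    (n : ℕ) (hn : 2 ≤ n)
    (a : Fin n → ℝ) (ha : ∑ i, a i = 0) (hstrict : StrictAnti a)
    (h₁ h₂ : Matrix (Fin n) (Fin n) ℝ) (hd₁ : h₁.det = 1) (hd₂ : h₂.det = 1)
    (hconj : h₁ * Matrix.diagonal (fun i => Real.exp (a i)) * h₁⁻¹
           = h₂ * Matrix.diagonal (fun i => Real.exp (a i)) * h₂⁻¹) :
    ∀ Y : Matrix (Fin n) (Fin n) ℝ, Y.trace = 0 →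
      pi0 (h₁⁻¹ * Y * h₁) = pi0 (h₂⁻¹ * Y * h₂) := by
  intro Y _
  have hu₁ : IsUnit h₁.det := hd₁ ▸ isUnit_one
  have hu₂ : IsUnit h₂.det := hd₂ ▸ isUnit_one
  have hcomm : Commute (h₁⁻¹ * h₂) (Matrix.diagonal fun i => Real.exp (a i)) := by
    have h := congrArg (fun X => h₁⁻¹ * X * h₂) hconj
    simp only [Matrix.mul_assoc, Matrix.nonsing_inv_mul _ hu₂, Matrix.mul_one,
      Matrix.nonsing_inv_mul_cancel_left _ _ hu₁] at h
    rw [Commute, SemiconjBy, Matrix.mul_assoc, h]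
  have hdiag := isDiag_of_commute_diagonal (Real.exp_injective.comp hstrict.injective) hcomm
  have hinv : h₂⁻¹ * h₁ * (h₁⁻¹ * h₂) = 1 := by
    rw [Matrix.mul_assoc, Matrix.mul_nonsing_inv_cancel_left _ _ hu₁, Matrix.nonsing_inv_mul _ hu₂]
  rw [← pi0_conj_of_isDiag hdiag hinv]
  simp only [Matrix.mul_assoc, Matrix.mul_nonsing_inv_cancel_left _ _ hu₁]

end
end
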